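/- Fix n ≥ 1, m ≥ 1, a matrix μ ∈ [0,1]^{n×m}, parameters β > 0, η > 0, and a partition S of {1,…,n} into nonempty groups; write s(i) for the group containing user i. Let w be a probability vector on {1,…,n} with w̄_s = Σ_{i∈s} w_i > 0 for every group s ∈ S. For π ∈ [0,1]^{n×m}, define the within-group exposures v_{j|s}(w, π) = Σ_{i∈s} (w_i/w̄_s) π_{ij}, the group-average v_{j|avg}(w, π) = (1/|S|) Σ_{s∈S} v_{j|s}(w, π), Z_j(w, π) = √(η + Σ_{s∈S} (v_{j|s}(w, π) − v_{j|avg}(w, π))²), and the normalized gradient of the balanced exposure objective: g_{w,ij}(π) = μ_{ij} − (β/(m Z_j(w, π) w̄_{s(i)})) (v_{j|s(i)}(w, π) − v_{j|avg}(w, π)). Consider T ≥ 1 i.i.d. samples i^(1),…,i^(T) from the categorical distribution with parameter w, an arbitrary initial π̂^(0) ∈ [0,1]^{n×m}, and an adapted sequence of actions a^(1),…,a^(T) ∈ [0,1]^m (a^(τ) measurable with respect to i^(1),…,i^(τ)). Define the counts c_i = #{τ ≤ T : i^(τ) = i} and c_s = Σ_{i∈s} c_i, the per-user averages π̂_{ij}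 = (1/c_i) Σ_{τ≤T} 1[i^(τ)=i] a^(τ)_j if c_i > 0 and π̂_{ij} = π̂^(0)_{ij} otherwise, the empirical group exposures v̂_{j|s} = (1/c_s) Σ_{τ≤T} 1[i^(τ)∈s] a^(τ)_j if c_s > 0 and v̂_{j|s} = 0 otherwise, v̂_{j|avg} = (1/|S|) Σ_{s∈S} v̂_{j|s}, Ẑ_j = √(η + Σ_{s∈S} (v̂_{j|s} − v̂_{j|avg})²), and the approximate gradient ĝ_{ij} = μ_{ij} − (β/(m Ẑ_j)) · ((T+1)/(c_{s(i)} + 1)) (v̂_{j|s(i)} − v̂_{j|avg}). Then for every user i ∈ {1,…,n}: E[ max_{j∈{1,…,m}} |ĝ_{ij} − g_{w,ij}(π̂)| ] ≤ (β / (m w̄_{s(i)} min(η, √η))) · ( 1/(w̄_{s(i)}(T+1)) + 8 Σ_{s∈S} √(|s| / (w̄_s T)) ). -/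

import Mathlib

/-- Number of occurrences of user `i` in the history `h`. -/
def usercount {n T : ℕ} (h : Fin T → Fin n) (i : Fin n) : ℕ :=
  (Finset.univ.filter (fun τ => h τ = i)).card

/-- `c_s = Σ_{i ∈ s} c_i`. -/
def groupcount {n T : ℕ} (h : Fin T → Fin n) (s : Finset (Fin n)) : ℕ :=
  ∑ i ∈ s, usercount h i

/-- `w̄_s = Σ_{i ∈ s} w_i`. -/
noncomputable def wbar {n : ℕ} (w : Fin n → ℝ) (s : Finset (Fin n)) : ℝ := ∑ i ∈ s, w i

/-- Within-group exposure `v_{j|s}(w, π) = Σ_{i ∈ s} (w_i / w̄_s) π_{ij}`. -/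
noncomputable def vgrp {n m : ℕ} (w : Fin n → ℝ) (π : Fin n → Fin m → ℝ)
    (s : Finset (Fin n)) (j : Fin m) : ℝ :=
  ∑ i ∈ s, (w i / wbar w s) * π i j

/-- Group-average exposure `v_{j|avg}(w, π) = (1/|S|) Σ_{s ∈ S} v_{j|s}(w, π)`. -/
noncomputable def vavg {n m : ℕ} (S : Finset (Finset (Fin n))) (w : Fin n → ℝ)
    (π : Fin n → Fin m → ℝ) (j : Fin m) : ℝ :=
  (1 / (S.card : ℝ)) * ∑ s ∈ S, vgrp w π s j

/-- `Z_j(w, π) = √(η + Σ_{s ∈ S} (v_{j|s} - v_{j|avg})²)`. -/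
noncomputable def Zbal {n m : ℕ} (S : Finset (Finset (Fin n))) (η : ℝ) (w : Fin n → ℝ)
    (π : Fin n → Fin m → ℝ) (j : Fin m) : ℝ :=
  Real.sqrt (η + ∑ s ∈ S, (vgrp w π s j - vavg S w π j) ^ 2)

/-- The normalized gradient of the balanced exposure objective:
`g_{w,ij}(π) = μ_{ij} - (β/(m Z_j(w,π) w̄_{s(i)})) (v_{j|s(i)}(w,π) - v_{j|avg}(w,π))`. -/
noncomputable def gbal {n m : ℕ} (S : Finset (Finset (Fin n))) (μ : Fin n → Fin m → ℝ)
    (β η : ℝ) (w : Fin n → ℝ) (sOf : Fin n → Finset (Fin n))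
    (π : Fin n → Fin m → ℝ) (i : Fin n) (j : Fin m) : ℝ :=
  μ i j - (β / ((m : ℝ) * Zbal S η w π j * wbar w (sOf i)))
    * (vgrp w π (sOf i) j - vavg S w π j)

/-- Empirical within-group exposure
`v̂_{j|s} = (1/c_s) Σ_{τ ≤ T} 1[i^{(τ)} ∈ s] a^{(τ)}_j` if `c_s > 0`, else `0`. -/
noncomputable def vgrpHat {n m T : ℕ} (a : Fin T → (Fin T → Fin n) → Fin m → ℝ)
    (h : Fin T → Fin n) (s : Finset (Fin n)) (j : Fin m) : ℝ :=
  if 0 < groupcount h s then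
    (1 / (groupcount h s : ℝ)) * ∑ τ, (if h τ ∈ s then a τ h j else 0)
  else 0

/-- `v̂_{j|avg} = (1/|S|) Σ_{s ∈ S} v̂_{j|s}`. -/
noncomputable def vavgHat {n m T : ℕ} (S : Finset (Finset (Fin n)))
    (a : Fin T → (Fin T → Fin n) → Fin m → ℝ) (h : Fin T → Fin n) (j : Fin m) : ℝ :=
  (1 / (S.card : ℝ)) * ∑ s ∈ S, vgrpHat a h s j

/-- `Ẑ_j = √(η + Σ_{s ∈ S} (v̂_{j|s} - v̂_{j|avg})²)`. -/
noncomputable def ZbalHat {n m T : ℕ} (S : Finset (Finset (Fin n))) (η : ℝ)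
    (a : Fin T → (Fin T → Fin n) → Fin m → ℝ) (h : Fin T → Fin n) (j : Fin m) : ℝ :=
  Real.sqrt (η + ∑ s ∈ S, (vgrpHat a h s j - vavgHat S a h j) ^ 2)

/-- Per-user average exposure
`π̂_{ij} = (1/c_i) Σ_{τ ≤ T} 1[i^{(τ)} = i] a^{(τ)}_j` if `c_i > 0`, else `π̂⁰_{ij}`. -/
noncomputable def pihatBal {n m T : ℕ} (a : Fin T → (Fin T → Fin n) → Fin m → ℝ)
    (pihat0 : Fin n → Fin m → ℝ) (h : Fin T → Fin n) (i : Fin n) (j : Fin m) : ℝ :=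
  if 0 < usercount h i then
    (1 / (usercount h i : ℝ)) * ∑ τ, (if h τ = i then a τ h j else 0)
  else pihat0 i j

/-- Expectation of `F` under `T` independent samples with weights `w`. -/
noncomputable def iidExp {α : Type*} [Fintype α] (w : α → ℝ) {T : ℕ} (F : (Fin T → α) → ℝ) : ℝ :=
  ∑ h : Fin T → α, (∏ τ, w (h τ)) * F h

section iidExp

variable {α : Type*} [Fintype α] {w : α → ℝ} {T : ℕ}

theorem iidExp_mono (hw : ∀ x, 0 ≤ w x) {F G : (Fin T → α) → ℝ} (hFG : ∀ h, F h ≤ G h) :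
    iidExp w F ≤ iidExp w G :=
  Finset.sum_le_sum fun h _ =>
    mul_le_mul_of_nonneg_left (hFG h) (Finset.prod_nonneg fun _ _ => hw _)

theorem iidExp_add (F G : (Fin T → α) → ℝ) :
    iidExp w (fun h => F h + G h) = iidExp w F + iidExp w G := by
  simp [iidExp, mul_add, Finset.sum_add_distrib]

theorem iidExp_const_mul (c : ℝ) (F : (Fin T → α) → ℝ) :
    iidExp w (fun h => c * F h) = c * iidExp w F := by
  simp only [iidExp, Finset.mul_sum]
  exact Finset.sum_congr rfl fun h _ => by ring

theorem iidExp_sum {ι : Type*} (s : Finset ι) (F : ι → (Fin T → α) → ℝ) :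
    iidExp w (fun h => ∑ k ∈ s, F k h) = ∑ k ∈ s, iidExp w (F k) := by
  simp only [iidExp, Finset.mul_sum]
  exact Finset.sum_comm

theorem iidExp_prod (g : α → ℝ) :
    iidExp w (fun h : Fin T → α => ∏ τ, g (h τ)) = (∑ x, w x * g x) ^ T := by
  simp only [iidExp, ← Finset.prod_mul_distrib]
  exact (Fintype.sum_pow (fun x => w x * g x) T).symm

theorem iidExp_one (hw1 : ∑ x, w x = 1) : iidExp w (fun _ : Fin T → α => (1 : ℝ)) = 1 := by
  simpa [hw1] using iidExp_prod (w := w) (T := T) (fun _ => 1)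

theorem iidExp_succ (F : (Fin (T + 1) → α) → ℝ) :
    iidExp w F = ∑ x, w x * iidExp w (fun h : Fin T → α => F (Fin.cons x h)) := by
  simp only [iidExp, Finset.mul_sum]
  rw [← (Fin.consEquiv fun _ : Fin (T + 1) => α).sum_comp, Fintype.sum_prod_type]
  refine Finset.sum_congr rfl fun x _ => Finset.sum_congr rfl fun h _ => ?_
  simp [Fin.consEquiv, Fin.prod_univ_succ, mul_assoc]

theorem iidExp_sum_apply (hw1 : ∑ x, w x = 1) (f : α → ℝ) :
    iidExp w (fun h : Fin T → α => ∑ τ, f (h τ)) = T * ∑ x, w x * f x := by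
  induction T with
  | zero => simp [iidExp]
  | succ T ih =>
    rw [iidExp_succ]
    simp only [Fin.sum_univ_succ, Fin.cons_zero, Fin.cons_succ, iidExp_add, ih]
    have hc (c : ℝ) : iidExp w (fun _ : Fin T → α => c) = c := by
      simpa [iidExp_one hw1] using iidExp_const_mul (w := w) c (fun _ : Fin T → α => 1)
    simp only [hc, mul_add, Finset.sum_add_distrib, ← Finset.sum_mul, hw1]
    push_cast; ring

theorem iidExp_sum_apply_sq (hw1 : ∑ x, w x = 1) (f : α → ℝ) (hf : ∑ x, w x * f x = 0) :
    iidExp w (fun h : Fin T → α => (∑ τ, f (h τ)) ^ 2) = T * ∑ x, w x * f x ^ 2 := by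
  induction T with
  | zero => simp [iidExp]
  | succ T ih =>
    have key (x : α) : iidExp w (fun h : Fin T → α => (f x + ∑ τ, f (h τ)) ^ 2) =
        f x ^ 2 + T * ∑ x, w x * f x ^ 2 := by
      have : (fun h : Fin T → α => (f x + ∑ τ, f (h τ)) ^ 2) = fun h =>
          (f x ^ 2 * 1 + (2 * f x) * ∑ τ, f (h τ)) + (∑ τ, f (h τ)) ^ 2 := by
        ext h; ring
      rw [this, iidExp_add, iidExp_add, iidExp_const_mul, iidExp_const_mul, iidExp_one hw1,
        iidExp_sum_apply hw1, hf, ih]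
      ring
    rw [iidExp_succ]
    simp only [Fin.sum_univ_succ, Fin.cons_zero, Fin.cons_succ, key]
    simp only [mul_add, Finset.sum_add_distrib, ← Finset.sum_mul, hw1]
    push_cast; ring

theorem iidExp_mul_le_sqrt_mul_sqrt (hw : ∀ x, 0 ≤ w x) (F G : (Fin T → α) → ℝ) :
    iidExp w (fun h => F h * G h) ≤
      √(iidExp w fun h => F h ^ 2) * √(iidExp w fun h => G h ^ 2) := by
  have hp (h : Fin T → α) : 0 ≤ ∏ τ, w (h τ) := Finset.prod_nonneg fun _ _ => hw _
  have := Real.sum_mul_le_sqrt_mul_sqrt Finset.univ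
    (fun h : Fin T → α => √(∏ τ, w (h τ)) * F h) (fun h => √(∏ τ, w (h τ)) * G h)
  simp only [mul_pow, Real.sq_sqrt (hp _)] at this
  refine le_trans (le_of_eq (Finset.sum_congr rfl fun h _ => ?_)) this
  rw [mul_mul_mul_comm, Real.mul_self_sqrt (hp h)]

theorem iidExp_abs_sum_apply_le (hw : ∀ x, 0 ≤ w x) (hw1 : ∑ x, w x = 1) (f : α → ℝ)
    (hf : ∑ x, w x * f x = 0) :
    iidExp w (fun h : Fin T → α => |∑ τ, f (h τ)|) ≤ √(T * ∑ x, w x * f x ^ 2) := by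
  have := iidExp_mul_le_sqrt_mul_sqrt hw (fun h : Fin T → α => |∑ τ, f (h τ)|) (fun _ => 1)
  simpa [iidExp_one hw1, iidExp_sum_apply_sq hw1 f hf] using this

end iidExp

section counts

variable {n T : ℕ}

theorem usercount_eq_sum (h : Fin T → Fin n) (i : Fin n) :
    (usercount h i : ℝ) = ∑ τ, if h τ = i then (1 : ℝ) else 0 := by
  simp [usercount]

theorem groupcount_eq_sum (h : Fin T → Fin n) (s : Finset (Fin n)) :
    (groupcount h s : ℝ) = ∑ τ, if h τ ∈ s then (1 : ℝ) else 0 := by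
  simp only [groupcount, Nat.cast_sum, usercount_eq_sum]
  rw [Finset.sum_comm]
  simp

theorem usercount_le_groupcount (h : Fin T → Fin n) {s : Finset (Fin n)} {i : Fin n}
    (hi : i ∈ s) : usercount h i ≤ groupcount h s :=
  Finset.single_le_sum (f := usercount h) (fun _ _ => Nat.zero_le _) hi

variable {w : Fin n → ℝ}

theorem sum_mul_ite_mem (s : Finset (Fin n)) :
    ∑ x, w x * (if x ∈ s then (1 : ℝ) else 0) = wbar w s := by
  simp [wbar]

theorem wbar_le_one (hw0 : ∀ i, 0 ≤ w i) (hw1 : ∑ i, w i = 1) (s : Finset (Fin n)) :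
    wbar w s ≤ 1 :=
  hw1 ▸ Finset.sum_le_sum_of_subset_of_nonneg (Finset.subset_univ s) fun _ _ _ => hw0 _

theorem iidExp_pow_groupcount (hw1 : ∑ i, w i = 1) (s : Finset (Fin n)) (x : ℝ) :
    iidExp w (fun h : Fin T → Fin n => x ^ groupcount h s) =
      (1 - wbar w s + wbar w s * x) ^ T := by
  have hpow (h : Fin T → Fin n) : x ^ groupcount h s = ∏ τ, if h τ ∈ s then x else 1 := by
    have : groupcount h s = ∑ τ, if h τ ∈ s then 1 else 0 := by
      exact_mod_cast groupcount_eq_sum h s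
    rw [this, ← Finset.prod_pow_eq_pow_sum]
    exact Finset.prod_congr rfl fun τ _ => by split_ifs <;> simp
  simp only [hpow]
  rw [iidExp_prod (fun i => if i ∈ s then x else 1)]
  congr 1
  have (i : Fin n) : w i * (if i ∈ s then x else 1) =
      w i + (x - 1) * (w i * if i ∈ s then 1 else 0) := by
    split_ifs <;> ring
  simp only [this]
  rw [Finset.sum_add_distrib, ← Finset.mul_sum, sum_mul_ite_mem, hw1]
  ring

theorem iidExp_inv_groupcount_add_one_le (hw0 : ∀ i, 0 ≤ w i) (hw1 : ∑ i, w i = 1)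
    {s : Finset (Fin n)} (hs : 0 < wbar w s) :
    iidExp w (fun h : Fin T → Fin n => 1 / ((groupcount h s : ℝ) + 1)) ≤
      1 / (((T : ℝ) + 1) * wbar w s) := by
  have hint : iidExp w (fun h : Fin T → Fin n => 1 / ((groupcount h s : ℝ) + 1)) =
      ∫ x in (0 : ℝ)..1, iidExp w (fun h : Fin T → Fin n => x ^ groupcount h s) := by
    simp only [iidExp]
    rw [intervalIntegral.integral_finsetSum fun h _ =>
      (by fun_prop : Continuous _).intervalIntegrable _ _]
    refine Finset.sum_congr rfl fun h _ => ?_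
    rw [intervalIntegral.integral_const_mul, integral_pow]
    simp
  simp only [hint, iidExp_pow_groupcount hw1]
  rw [intervalIntegral.integral_comp_add_mul (fun x : ℝ => x ^ T) hs.ne', integral_pow]
  have h1 : 0 ≤ (1 - wbar w s) ^ (T + 1) :=
    pow_nonneg (sub_nonneg.2 (wbar_le_one hw0 hw1 s)) _
  have h2 : (0 : ℝ) < T + 1 := by positivity
  simp only [mul_zero, add_zero, mul_one, sub_add_cancel, one_pow, smul_eq_mul]
  rw [one_div, mul_inv, mul_comm, div_eq_mul_inv]
  gcongr
  exact mul_le_of_le_one_left (by positivity) (by linarith)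

theorem iidExp_abs_div_groupcount_add_one_le (hw0 : ∀ i, 0 ≤ w i) (hw1 : ∑ i, w i = 1)
    {s : Finset (Fin n)} (hs : 0 < wbar w s) :
    iidExp w (fun h : Fin T → Fin n =>
        |((T : ℝ) + 1) * wbar w s - ((groupcount h s : ℝ) + 1)| / ((groupcount h s : ℝ) + 1)) ≤
      √(1 / (((T : ℝ) + 1) * wbar w s)) := by
  set A : ℝ := ((T : ℝ) + 1) * wbar w s with hA
  have hA0 : 0 < A := by positivity
  have hinv := iidExp_inv_groupcount_add_one_le (T := T) hw0 hw1 hs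
  rw [← hA] at hinv
  have hu (h : Fin T → Fin n) : (0 : ℝ) < (groupcount h s : ℝ) + 1 := by positivity
  have hsq : iidExp w (fun h : Fin T → Fin n =>
      (|A - ((groupcount h s : ℝ) + 1)| / √((groupcount h s : ℝ) + 1)) ^ 2) ≤ 1 := by
    have hexp (h : Fin T → Fin n) :
        (|A - ((groupcount h s : ℝ) + 1)| / √((groupcount h s : ℝ) + 1)) ^ 2 =
        A ^ 2 * (1 / ((groupcount h s : ℝ) + 1)) +
          ((1 - 2 * A) * 1 + ∑ τ, if h τ ∈ s then (1 : ℝ) else 0) := by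
      rw [div_pow, sq_abs, Real.sq_sqrt (hu h).le, ← groupcount_eq_sum]
      have := (hu h).ne'
      field_simp
      ring
    simp only [hexp]
    rw [iidExp_add, iidExp_add, iidExp_const_mul, iidExp_const_mul, iidExp_one hw1,
      iidExp_sum_apply hw1 (fun i => if i ∈ s then 1 else 0), sum_mul_ite_mem]
    have h1 : A ^ 2 * iidExp w (fun h : Fin T → Fin n => 1 / ((groupcount h s : ℝ) + 1)) ≤ A :=
      (mul_le_mul_of_nonneg_left hinv (sq_nonneg A)).trans (le_of_eq (by field_simp))
    linarith
  have hcs := iidExp_mul_le_sqrt_mul_sqrt hw0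
    (fun h : Fin T → Fin n => |A - ((groupcount h s : ℝ) + 1)| / √((groupcount h s : ℝ) + 1))
    (fun h => 1 / √((groupcount h s : ℝ) + 1))
  have hl (h : Fin T → Fin n) :
      |A - ((groupcount h s : ℝ) + 1)| / √((groupcount h s : ℝ) + 1) *
        (1 / √((groupcount h s : ℝ) + 1)) =
      |A - ((groupcount h s : ℝ) + 1)| / ((groupcount h s : ℝ) + 1) := by
    rw [div_mul_div_comm, mul_one, Real.mul_self_sqrt (hu h).le]
  have hr (h : Fin T → Fin n) : (1 / √((groupcount h s : ℝ) + 1)) ^ 2 =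
      1 / ((groupcount h s : ℝ) + 1) := by
    rw [div_pow, one_pow, Real.sq_sqrt (hu h).le]
  simp only [hl, hr] at hcs
  calc _ ≤ _ := hcs
    _ ≤ √1 * √(1 / A) := by gcongr
    _ = _ := by simp

/-- The `ℓ¹` distance between the empirical and the true distribution of users within a group. -/
noncomputable def groupFreqDist (w : Fin n → ℝ) (h : Fin T → Fin n) (s : Finset (Fin n)) : ℝ :=
  ∑ i ∈ s, |(usercount h i : ℝ) / groupcount h s - w i / wbar w s|

theorem sum_div_wbar {s : Finset (Fin n)} (hs : 0 < wbar w s) : ∑ i ∈ s, w i / wbar w s = 1 := by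
  rw [← Finset.sum_div]
  exact div_self hs.ne'

theorem groupFreqDist_le_two (hw0 : ∀ i, 0 ≤ w i) {s : Finset (Fin n)} (hs : 0 < wbar w s)
    (h : Fin T → Fin n) : groupFreqDist w h s ≤ 2 := by
  calc groupFreqDist w h s
      ≤ ∑ i ∈ s, ((usercount h i : ℝ) / groupcount h s + w i / wbar w s) := by
        refine Finset.sum_le_sum fun i _ => (abs_sub _ _).trans (le_of_eq ?_)
        rw [abs_of_nonneg (by positivity), abs_of_nonneg (div_nonneg (hw0 i) hs.le)]
    _ = (groupcount h s : ℝ) / groupcount h s + 1 := by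
        rw [Finset.sum_add_distrib, sum_div_wbar hs, ← Finset.sum_div, groupcount, Nat.cast_sum]
    _ ≤ 2 := by linarith [div_self_le_one (groupcount h s : ℝ)]

theorem groupFreqDist_le (hw0 : ∀ i, 0 ≤ w i) {s : Finset (Fin n)} (hs : 0 < wbar w s)
    (hT : 1 ≤ T) (h : Fin T → Fin n) :
    groupFreqDist w h s ≤ 1 / (wbar w s * T) *
      ((∑ i ∈ s, |∑ τ, ((if h τ = i then (1 : ℝ) else 0) -
          w i / wbar w s * if h τ ∈ s then 1 else 0)|) +
        2 * |∑ τ, ((if h τ ∈ s then (1 : ℝ) else 0) - wbar w s)|) := by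
  have hT0 : (0 : ℝ) < T := by exact_mod_cast hT
  have hM : 0 < wbar w s * T := by positivity
  set c : ℝ := (groupcount h s : ℝ) with hc
  have e1 (i : Fin n) : ∑ τ, ((if h τ = i then (1 : ℝ) else 0) -
      w i / wbar w s * if h τ ∈ s then 1 else 0) = usercount h i - w i / wbar w s * c := by
    rw [Finset.sum_sub_distrib, ← Finset.mul_sum, ← usercount_eq_sum, ← groupcount_eq_sum]
  have e2 : ∑ τ, ((if h τ ∈ s then (1 : ℝ) else 0) - wbar w s) = c - wbar w s * T := by
    rw [Finset.sum_sub_distrib, ← groupcount_eq_sum]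
    simp [hc, mul_comm]
  simp only [e1, e2]
  have hD2 := groupFreqDist_le_two hw0 hs h
  have hterm : ∀ i ∈ s, (wbar w s * T) * |(usercount h i : ℝ) / c - w i / wbar w s| ≤
      |usercount h i - w i / wbar w s * c| +
        |c - wbar w s * T| * |(usercount h i : ℝ) / c - w i / wbar w s| := by
    intro i hi
    have hcu : (usercount h i : ℝ) / c * c = usercount h i := by
      rcases eq_or_ne c 0 with h0 | h0
      · have : usercount h i ≤ groupcount h s := usercount_le_groupcount h hi
        have h0' : groupcount h s = 0 := by exact_mod_cast hc ▸ h0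
        have : usercount h i = 0 := by omega
        simp [this]
      · field_simp
    have : (wbar w s * T) * ((usercount h i : ℝ) / c - w i / wbar w s) =
        (usercount h i - w i / wbar w s * c) -
          (c - wbar w s * T) * ((usercount h i : ℝ) / c - w i / wbar w s) := by
      linear_combination hcu
    rw [← abs_of_pos hM, ← abs_mul, this, abs_of_pos hM, ← abs_mul]
    exact abs_sub _ _
  have hsum := Finset.sum_le_sum hterm
  rw [Finset.sum_add_distrib, ← Finset.mul_sum, ← Finset.mul_sum] at hsum
  rw [one_div, inv_mul_eq_div, le_div_iff₀ hM, mul_comm]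
  refine hsum.trans ?_
  rw [mul_comm 2]
  gcongr
  exact hD2

theorem iidExp_groupFreqDist_le (hw0 : ∀ i, 0 ≤ w i) (hw1 : ∑ i, w i = 1)
    {s : Finset (Fin n)} (hsne : s.Nonempty) (hs : 0 < wbar w s) (hT : 1 ≤ T) :
    iidExp w (fun h : Fin T → Fin n => groupFreqDist w h s) ≤
      3 * √((s.card : ℝ) / (wbar w s * T)) := by
  have hT0 : (0 : ℝ) < T := by exact_mod_cast hT
  have hM : 0 < wbar w s * T := by positivity
  have hcard : (1 : ℝ) ≤ s.card := by exact_mod_cast hsne.card_pos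
  have hW1 := wbar_le_one hw0 hw1 s
  have huser : ∀ i ∈ s, iidExp w (fun h : Fin T → Fin n =>
      |∑ τ, ((if h τ = i then (1 : ℝ) else 0) - w i / wbar w s * if h τ ∈ s then 1 else 0)|) ≤
      √T * √(w i) := by
    intro i hi
    have hp : w i / wbar w s * wbar w s = w i := div_mul_cancel₀ _ hs.ne'
    have hmean : ∑ x, w x * ((if x = i then (1 : ℝ) else 0) -
        w i / wbar w s * if x ∈ s then 1 else 0) = 0 := by
      simp only [mul_sub, mul_left_comm _ (w i / wbar w s), Finset.sum_sub_distrib,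
        ← Finset.mul_sum, sum_mul_ite_mem, hp]
      simp
    refine (iidExp_abs_sum_apply_le hw0 hw1 (fun x => (if x = i then (1 : ℝ) else 0) -
      w i / wbar w s * if x ∈ s then 1 else 0) hmean).trans ?_
    rw [← Real.sqrt_mul hT0.le]
    gcongr
    have hsq (x : Fin n) : w x * ((if x = i then (1 : ℝ) else 0) -
        w i / wbar w s * if x ∈ s then 1 else 0) ^ 2 =
        (1 - 2 * (w i / wbar w s)) * (w x * if x = i then (1 : ℝ) else 0) +
        (w i / wbar w s) ^ 2 * (w x * if x ∈ s then (1 : ℝ) else 0) := by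
      by_cases hx : x = i
      · subst hx; simp only [if_true, hi]; ring
      · simp only [hx, if_false]; split_ifs <;> ring
    simp only [hsq]
    rw [Finset.sum_add_distrib, ← Finset.mul_sum, ← Finset.mul_sum, sum_mul_ite_mem]
    simp only [mul_ite, mul_one, mul_zero, Finset.sum_ite_eq', Finset.mem_univ, if_true]
    have h0 : 0 ≤ w i / wbar w s := div_nonneg (hw0 i) hs.le
    have : (w i / wbar w s) ^ 2 * wbar w s = w i / wbar w s * w i := by
      rw [sq, mul_assoc, hp]
    rw [this]
    nlinarith [mul_nonneg h0 (hw0 i)]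
  have hgroup : iidExp w (fun h : Fin T → Fin n =>
      |∑ τ, ((if h τ ∈ s then (1 : ℝ) else 0) - wbar w s)|) ≤ √(wbar w s * T) := by
    have hmean : ∑ x, w x * ((if x ∈ s then (1 : ℝ) else 0) - wbar w s) = 0 := by
      simp only [mul_sub, Finset.sum_sub_distrib, sum_mul_ite_mem, ← Finset.sum_mul, hw1]
      ring
    refine (iidExp_abs_sum_apply_le hw0 hw1
      (fun x => (if x ∈ s then (1 : ℝ) else 0) - wbar w s) hmean).trans ?_
    rw [mul_comm (T : ℝ)]
    gcongr
    have hsq (x : Fin n) : w x * ((if x ∈ s then (1 : ℝ) else 0) - wbar w s) ^ 2 =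
        (1 - 2 * wbar w s) * (w x * if x ∈ s then (1 : ℝ) else 0) + w x * wbar w s ^ 2 := by
      split_ifs <;> ring
    simp only [hsq]
    rw [Finset.sum_add_distrib, ← Finset.mul_sum, ← Finset.sum_mul, sum_mul_ite_mem, hw1]
    nlinarith
  have hsumsqrt : ∑ i ∈ s, √(w i) ≤ √s.card * √(wbar w s) := by
    have := Real.sum_mul_le_sqrt_mul_sqrt s (fun _ => (1 : ℝ)) (fun i => √(w i))
    simpa [Real.sq_sqrt (hw0 _), wbar] using this
  refine (iidExp_mono hw0 (groupFreqDist_le hw0 hs hT)).trans ?_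
  rw [iidExp_const_mul, iidExp_add, iidExp_sum, iidExp_const_mul, one_div, inv_mul_eq_div,
    div_le_iff₀ hM]
  calc _ ≤ (∑ i ∈ s, √T * √(w i)) + 2 * √(wbar w s * T) :=
        add_le_add (Finset.sum_le_sum huser) (by linarith)
    _ ≤ √T * (√s.card * √(wbar w s)) + 2 * (√s.card * √(wbar w s * T)) := by
        rw [← Finset.mul_sum]
        gcongr
        exact le_mul_of_one_le_left (Real.sqrt_nonneg _) (Real.one_le_sqrt.2 hcard)
    _ = 3 * √((s.card : ℝ) / (wbar w s * T)) * (wbar w s * T) := by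
        rw [Real.sqrt_div (by positivity), mul_assoc, div_mul_eq_mul_div, mul_div_assoc,
          Real.div_sqrt, Real.sqrt_mul hs.le]
        ring

end counts

section exposures

variable {n m T : ℕ} {w : Fin n → ℝ} {a : Fin T → (Fin T → Fin n) → Fin m → ℝ}
  {pihat0 : Fin n → Fin m → ℝ}

theorem sum_ite_eq_usercount_mul (h : Fin T → Fin n) (i : Fin n) (j : Fin m) :
    ∑ τ, (if h τ = i then a τ h j else 0) = usercount h i * pihatBal a pihat0 h i j := by
  unfold pihatBal
  split_ifs with h0
  · have : (usercount h i : ℝ) ≠ 0 := by exact_mod_cast h0.ne'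
    field_simp
  · have h0' : usercount h i = 0 := by omega
    have hne (τ : Fin T) : h τ ≠ i := by
      simpa using (Finset.filter_eq_empty_iff.1 (Finset.card_eq_zero.1 h0')) (Finset.mem_univ τ)
    simp [h0', hne]

theorem vgrpHat_eq_sum (pihat0 : Fin n → Fin m → ℝ) (h : Fin T → Fin n) (s : Finset (Fin n))
    (j : Fin m) :
    vgrpHat a h s j =
      ∑ i ∈ s, (usercount h i : ℝ) / groupcount h s * pihatBal a pihat0 h i j := by
  unfold vgrpHat
  split_ifs with h0
  · have : ∑ τ, (if h τ ∈ s then a τ h j else 0) =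
        ∑ i ∈ s, ∑ τ, (if h τ = i then a τ h j else 0) := by
      rw [Finset.sum_comm]
      simp
    rw [this, Finset.mul_sum]
    refine Finset.sum_congr rfl fun i _ => ?_
    rw [sum_ite_eq_usercount_mul (pihat0 := pihat0)]
    ring
  · have : groupcount h s = 0 := by omega
    simp [this]

theorem pihatBal_mem_Icc (ha01 : ∀ τ h j, a τ h j ∈ Set.Icc (0 : ℝ) 1)
    (hpihat0 : ∀ i j, pihat0 i j ∈ Set.Icc (0 : ℝ) 1) (h : Fin T → Fin n) (i : Fin n)
    (j : Fin m) : pihatBal a pihat0 h i j ∈ Set.Icc (0 : ℝ) 1 := by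
  unfold pihatBal
  split_ifs with h0
  · have h0' : (0 : ℝ) < usercount h i := by exact_mod_cast h0
    rw [one_div, inv_mul_eq_div]
    refine ⟨div_nonneg (Finset.sum_nonneg fun τ _ => ?_) h0'.le, (div_le_one h0').2 ?_⟩
    · split_ifs
      exacts [(ha01 τ h j).1, le_rfl]
    · rw [usercount_eq_sum]
      refine Finset.sum_le_sum fun τ _ => ?_
      split_ifs
      exacts [(ha01 τ h j).2, le_rfl]
  · exact hpihat0 i j

theorem vgrpHat_mem_Icc (ha01 : ∀ τ h j, a τ h j ∈ Set.Icc (0 : ℝ) 1) (h : Fin T → Fin n)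
    (s : Finset (Fin n)) (j : Fin m) : vgrpHat a h s j ∈ Set.Icc (0 : ℝ) 1 := by
  unfold vgrpHat
  split_ifs with h0
  · have h0' : (0 : ℝ) < groupcount h s := by exact_mod_cast h0
    rw [one_div, inv_mul_eq_div]
    refine ⟨div_nonneg (Finset.sum_nonneg fun τ _ => ?_) h0'.le, (div_le_one h0').2 ?_⟩
    · split_ifs
      exacts [(ha01 τ h j).1, le_rfl]
    · rw [groupcount_eq_sum]
      refine Finset.sum_le_sum fun τ _ => ?_
      split_ifs
      exacts [(ha01 τ h j).2, le_rfl]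
  · simp

theorem abs_vgrpHat_sub_vgrp_le (ha01 : ∀ τ h j, a τ h j ∈ Set.Icc (0 : ℝ) 1)
    (hpihat0 : ∀ i j, pihat0 i j ∈ Set.Icc (0 : ℝ) 1) (h : Fin T → Fin n)
    (s : Finset (Fin n)) (j : Fin m) :
    |vgrpHat a h s j - vgrp w (pihatBal a pihat0 h) s j| ≤ groupFreqDist w h s := by
  rw [vgrpHat_eq_sum pihat0, vgrp, ← Finset.sum_sub_distrib]
  refine (Finset.abs_sum_le_sum_abs _ _).trans (Finset.sum_le_sum fun i _ => ?_)
  obtain ⟨h0, h1⟩ := pihatBal_mem_Icc ha01 hpihat0 h i j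
  rw [← sub_mul, abs_mul, abs_of_nonneg h0]
  exact mul_le_of_le_one_right (abs_nonneg _) h1

end exposures

section normalization

variable {ι : Type*} {S : Finset ι}

theorem abs_sqrt_add_sum_sq_sub_le {η : ℝ} (hη : 0 < η) (x y : ι → ℝ) :
    |√(η + ∑ s ∈ S, x s ^ 2) - √(η + ∑ s ∈ S, y s ^ 2)| ≤ √(∑ s ∈ S, (x s - y s) ^ 2) := by
  have key (x y : ι → ℝ) : √(η + ∑ s ∈ S, x s ^ 2) ≤
      √(η + ∑ s ∈ S, y s ^ 2) + √(∑ s ∈ S, (x s - y s) ^ 2) := by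
    have hY : 0 ≤ ∑ s ∈ S, y s ^ 2 := Finset.sum_nonneg fun _ _ => sq_nonneg _
    have hN : 0 ≤ ∑ s ∈ S, (x s - y s) ^ 2 := Finset.sum_nonneg fun _ _ => sq_nonneg _
    have hcs := Real.sum_mul_le_sqrt_mul_sqrt S y (fun s => x s - y s)
    have hle : √(∑ s ∈ S, y s ^ 2) ≤ √(η + ∑ s ∈ S, y s ^ 2) := Real.sqrt_le_sqrt (by linarith)
    have hmul := mul_le_mul_of_nonneg_right hle (Real.sqrt_nonneg (∑ s ∈ S, (x s - y s) ^ 2))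
    have hx : ∑ s ∈ S, x s ^ 2 = ∑ s ∈ S, y s ^ 2 + 2 * ∑ s ∈ S, y s * (x s - y s) +
        ∑ s ∈ S, (x s - y s) ^ 2 := by
      rw [Finset.mul_sum, ← Finset.sum_add_distrib, ← Finset.sum_add_distrib]
      exact Finset.sum_congr rfl fun s _ => by ring
    refine Real.sqrt_le_iff.2 ⟨by positivity, ?_⟩
    rw [add_sq, Real.sq_sqrt (by linarith), Real.sq_sqrt hN]
    linarith
  have h1 := key x y
  have h2 := key y x
  simp only [sub_sq_comm (y _)] at h2
  rw [abs_sub_le_iff]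
  constructor <;> linarith

theorem abs_le_sqrt_sum_sq (x : ι → ℝ) {s : ι} (hs : s ∈ S) : |x s| ≤ √(∑ s ∈ S, x s ^ 2) :=
  Real.abs_le_sqrt (Finset.single_le_sum (f := fun s => x s ^ 2) (fun _ _ => sq_nonneg _) hs)

theorem abs_div_sqrt_sub_div_sqrt_le {η : ℝ} (hη : 0 < η) (x y : ι → ℝ) {s : ι} (hs : s ∈ S) :
    |x s / √(η + ∑ s ∈ S, x s ^ 2) - y s / √(η + ∑ s ∈ S, y s ^ 2)| ≤
      2 * √(∑ s ∈ S, (x s - y s) ^ 2) / √η := by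
  have hX : 0 ≤ ∑ s ∈ S, x s ^ 2 := Finset.sum_nonneg fun _ _ => sq_nonneg _
  have hY : 0 ≤ ∑ s ∈ S, y s ^ 2 := Finset.sum_nonneg fun _ _ => sq_nonneg _
  have hN := abs_sqrt_add_sum_sq_sub_le (S := S) hη y x
  have hd := abs_le_sqrt_sum_sq (fun s => x s - y s) hs
  simp only [sub_sq_comm (y _)] at hN
  have hyZ : |y s| ≤ √(η + ∑ s ∈ S, y s ^ 2) :=
    (abs_le_sqrt_sum_sq y hs).trans (Real.sqrt_le_sqrt (by linarith))
  have hZ : √η ≤ √(η + ∑ s ∈ S, x s ^ 2) := Real.sqrt_le_sqrt (by linarith)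
  have hη' : 0 < √η := Real.sqrt_pos.2 hη
  have hZ' : 0 < √(η + ∑ s ∈ S, y s ^ 2) := Real.sqrt_pos.2 (by linarith)
  set N := √(∑ s ∈ S, (x s - y s) ^ 2)
  set Zx := √(η + ∑ s ∈ S, x s ^ 2)
  set Zy := √(η + ∑ s ∈ S, y s ^ 2)
  have hZx : 0 < Zx := hη'.trans_le hZ
  have heq : x s / Zx - y s / Zy = ((x s - y s) + y s / Zy * (Zy - Zx)) / Zx := by
    field_simp
    ring
  rw [heq, abs_div, abs_of_pos hZx]
  have hnum : |(x s - y s) + y s / Zy * (Zy - Zx)| ≤ 2 * N := by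
    have h1 : |y s / Zy| ≤ 1 := by
      rw [abs_div, abs_of_pos hZ']
      exact (div_le_one hZ').2 hyZ
    calc _ ≤ |x s - y s| + |y s / Zy| * |Zy - Zx| := by
          rw [← abs_mul]
          exact abs_add_le _ _
      _ ≤ N + 1 * N := by gcongr
      _ = 2 * N := by ring
  gcongr

theorem sqrt_sum_sub_mean_sq_le (e : ι → ℝ) :
    √(∑ s ∈ S, (e s - 1 / (S.card : ℝ) * ∑ t ∈ S, e t) ^ 2) ≤ ∑ s ∈ S, |e s| := by
  refine Real.sqrt_le_iff.2 ⟨Finset.sum_nonneg fun _ _ => abs_nonneg _, ?_⟩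
  have h1 : ∑ s ∈ S, e s ^ 2 ≤ (∑ s ∈ S, |e s|) ^ 2 := by
    have := Finset.sum_sq_le_sq_sum_of_nonneg (s := S) (f := fun s => |e s|)
      (fun _ _ => abs_nonneg _)
    simpa [sq_abs] using this
  refine le_trans ?_ h1
  rcases S.eq_empty_or_nonempty with rfl | hne
  · simp
  have hc : (S.card : ℝ) ≠ 0 := by exact_mod_cast hne.card_pos.ne'
  have hsq (M : ℝ) : ∑ s ∈ S, (e s - M) ^ 2 =
      ∑ s ∈ S, e s ^ 2 - 2 * M * ∑ s ∈ S, e s + S.card * M ^ 2 := by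
    simp only [sub_sq, Finset.sum_add_distrib, Finset.sum_sub_distrib, Finset.sum_const,
      nsmul_eq_mul, Finset.mul_sum]
    congr 2
    exact Finset.sum_congr rfl fun s _ => by ring
  rw [hsq]
  set E := ∑ t ∈ S, e t
  have : ∑ s ∈ S, e s ^ 2 - 2 * (1 / (S.card : ℝ) * E) * E + S.card * (1 / (S.card : ℝ) * E) ^ 2 =
      ∑ s ∈ S, e s ^ 2 - E ^ 2 / S.card := by
    field_simp
    ring
  rw [this]
  have : 0 ≤ E ^ 2 / S.card := by positivity
  linarith

theorem abs_sub_mean_le_one {v : ι → ℝ} (hv : ∀ s ∈ S, v s ∈ Set.Icc (0 : ℝ) 1) {s : ι}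
    (hs : s ∈ S) : |v s - 1 / (S.card : ℝ) * ∑ t ∈ S, v t| ≤ 1 := by
  have hc : (0 : ℝ) < S.card := by exact_mod_cast Finset.card_pos.2 ⟨s, hs⟩
  have h0 : 0 ≤ ∑ t ∈ S, v t := Finset.sum_nonneg fun t ht => (hv t ht).1
  have h1 : ∑ t ∈ S, v t ≤ S.card := by
    simpa using Finset.sum_le_sum fun t ht => (hv t ht).2
  rw [one_div, inv_mul_eq_div, abs_sub_le_iff]
  have h2 : (∑ t ∈ S, v t) / S.card ≤ 1 := (div_le_one hc).2 h1
  have h3 : 0 ≤ (∑ t ∈ S, v t) / S.card := by positivity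
  constructor <;> linarith [(hv s hs).1, (hv s hs).2]

end normalization

theorem abs_approxGradient_sub_gbal_le {n m T : ℕ} (hm : 1 ≤ m) (μ : Fin n → Fin m → ℝ)
    {β η : ℝ} (hβ : 0 < β) (hη : 0 < η) {S : Finset (Finset (Fin n))}
    {sOf : Fin n → Finset (Fin n)} {w : Fin n → ℝ} {i : Fin n} (hs : sOf i ∈ S)
    (hW : 0 < wbar w (sOf i)) {a : Fin T → (Fin T → Fin n) → Fin m → ℝ}
    {pihat0 : Fin n → Fin m → ℝ} (hpihat0 : ∀ i j, pihat0 i j ∈ Set.Icc (0 : ℝ) 1)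
    (ha01 : ∀ τ h j, a τ h j ∈ Set.Icc (0 : ℝ) 1) (h : Fin T → Fin n) (j : Fin m) :
    |(μ i j - (β / ((m : ℝ) * ZbalHat S η a h j))
        * (((T : ℝ) + 1) / ((groupcount h (sOf i) : ℝ) + 1))
        * (vgrpHat a h (sOf i) j - vavgHat S a h j))
      - gbal S μ β η w sOf (pihatBal a pihat0 h) i j| ≤
    β / (m * wbar w (sOf i) * √η) *
      (|((T : ℝ) + 1) * wbar w (sOf i) - ((groupcount h (sOf i) : ℝ) + 1)| /
          ((groupcount h (sOf i) : ℝ) + 1) +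
        2 * ∑ s ∈ S, groupFreqDist w h s) := by
  set x : Finset (Fin n) → ℝ := fun s => vgrpHat a h s j - vavgHat S a h j with hx
  set y : Finset (Fin n) → ℝ := fun s => vgrp w (pihatBal a pihat0 h) s j -
    vavg S w (pihatBal a pihat0 h) j with hy
  have hm0 : (0 : ℝ) < m := by exact_mod_cast hm
  have hη' : 0 < √η := Real.sqrt_pos.2 hη
  have hxS : 0 ≤ ∑ s ∈ S, x s ^ 2 := Finset.sum_nonneg fun _ _ => sq_nonneg _
  have hyS : 0 ≤ ∑ s ∈ S, y s ^ 2 := Finset.sum_nonneg fun _ _ => sq_nonneg _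
  have hZ : √η ≤ ZbalHat S η a h j := Real.sqrt_le_sqrt (by linarith)
  have hZ' : 0 < Zbal S η w (pihatBal a pihat0 h) j := Real.sqrt_pos.2 (by linarith)
  have hlip : |x (sOf i) / ZbalHat S η a h j -
      y (sOf i) / Zbal S η w (pihatBal a pihat0 h) j| ≤
      2 * (∑ s ∈ S, groupFreqDist w h s) / √η := by
    refine (abs_div_sqrt_sub_div_sqrt_le hη x y hs).trans ?_
    gcongr
    have hxy (s : Finset (Fin n)) : x s - y s =
        (vgrpHat a h s j - vgrp w (pihatBal a pihat0 h) s j) - 1 / (S.card : ℝ) *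
          ∑ t ∈ S, (vgrpHat a h t j - vgrp w (pihatBal a pihat0 h) t j) := by
      rw [Finset.sum_sub_distrib]
      simp only [hx, hy, vavgHat, vavg]
      ring
    simp only [hxy]
    exact (sqrt_sum_sub_mean_sq_le _).trans
      (Finset.sum_le_sum fun s _ => abs_vgrpHat_sub_vgrp_le ha01 hpihat0 h s j)
  have hx1 : |x (sOf i)| ≤ 1 :=
    abs_sub_mean_le_one (fun s _ => vgrpHat_mem_Icc ha01 h s j) hs
  change |(μ i j - (β / ((m : ℝ) * ZbalHat S η a h j))
        * (((T : ℝ) + 1) / ((groupcount h (sOf i) : ℝ) + 1)) * x (sOf i))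
      - (μ i j - (β / ((m : ℝ) * Zbal S η w (pihatBal a pihat0 h) j * wbar w (sOf i)))
        * y (sOf i))| ≤ _
  set W := wbar w (sOf i)
  set u : ℝ := (groupcount h (sOf i) : ℝ) + 1
  set Z := ZbalHat S η a h j
  set Z' := Zbal S η w (pihatBal a pihat0 h) j
  have hu : 0 < u := by positivity
  have hZ0 : 0 < Z := hη'.trans_le hZ
  have heq : (μ i j - (β / (m * Z)) * (((T : ℝ) + 1) / u) * x (sOf i))
      - (μ i j - (β / (m * Z' * W)) * y (sOf i)) =
      -(β / (m * W)) * ((((T : ℝ) + 1) * W - u) / u * (x (sOf i) / Z) +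
        (x (sOf i) / Z - y (sOf i) / Z')) := by
    field_simp
    ring
  rw [heq, abs_mul, abs_neg, abs_of_pos (by positivity : 0 < β / (m * W))]
  have hxZ : |x (sOf i) / Z| ≤ 1 / √η := by
    rw [abs_div, abs_of_pos hZ0]
    gcongr
  calc _ ≤ β / (m * W) * (|((T : ℝ) + 1) * W - u| / u * (1 / √η) +
        2 * (∑ s ∈ S, groupFreqDist w h s) / √η) := by
        gcongr
        refine (abs_add_le _ _).trans (add_le_add ?_ hlip)
        rw [abs_mul, abs_div, abs_of_pos hu]
        gcongr
    _ = _ := by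
        field_simp

/-- Deviation bound for the approximate gradient of the balanced exposure objective
(Proposition 2, Algorithm 3).  The samples `i^{(1)},…,i^{(T)}` are encoded as a history
`h : Fin T → Fin n`, i.i.d. categorical with parameter `w`; the expectation of a
function `F` of the samples is `∑ h, (∏ τ, w (h τ)) * F h`.  The actions `a^{(τ)}`
are adapted: `a τ h` only depends on `h τ'` for `τ' ≤ τ`.  `sOf i` is the group of
user `i` in the partition `S` of `{1,…,n}`. -/
theorem balanced_gradient_deviation
    (n m : ℕ) (hn : 1 ≤ n) (hm : 1 ≤ m)
    (μ : Fin n → Fin m → ℝ) (hμ : ∀ i j, μ i j ∈ Set.Icc (0 : ℝ) 1)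
    (β η : ℝ) (hβ : 0 < β) (hη : 0 < η)
    (S : Finset (Finset (Fin n)))
    (hSne : ∀ s ∈ S, s.Nonempty)
    (hdisj : (S : Set (Finset (Fin n))).Pairwise (fun s s' => Disjoint s s'))
    (hcover : ∀ i : Fin n, ∃ s ∈ S, i ∈ s)
    (sOf : Fin n → Finset (Fin n)) (hsOf : ∀ i, sOf i ∈ S ∧ i ∈ sOf i)
    (w : Fin n → ℝ) (hw0 : ∀ i, 0 ≤ w i) (hw1 : ∑ i, w i = 1)
    (hwbar : ∀ s ∈ S, 0 < wbar w s)
    (T : ℕ) (hT : 1 ≤ T)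
    (pihat0 : Fin n → Fin m → ℝ) (hpihat0 : ∀ i j, pihat0 i j ∈ Set.Icc (0 : ℝ) 1)
    (a : Fin T → (Fin T → Fin n) → Fin m → ℝ)
    (ha01 : ∀ τ h j, a τ h j ∈ Set.Icc (0 : ℝ) 1)
    (hadapted : ∀ (τ : Fin T) (h h' : Fin T → Fin n),
      (∀ τ' : Fin T, τ' ≤ τ → h τ' = h' τ') → a τ h = a τ h')
    (i : Fin n) :
    ∑ h : Fin T → Fin n, (∏ τ, w (h τ)) *
      (⨆ j : Fin m,
        |(μ i j - (β / ((m : ℝ) * ZbalHat S η a h j))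
            * (((T : ℝ) + 1) / ((groupcount h (sOf i) : ℝ) + 1))
            * (vgrpHat a h (sOf i) j - vavgHat S a h j))
          - gbal S μ β η w sOf (pihatBal a pihat0 h) i j|)
      ≤ (β / ((m : ℝ) * wbar w (sOf i) * min η (Real.sqrt η)))
        * (1 / (wbar w (sOf i) * ((T : ℝ) + 1))
            + 8 * ∑ s ∈ S, Real.sqrt ((s.card : ℝ) / (wbar w s * (T : ℝ)))) := by
  have : Nonempty (Fin m) := ⟨⟨0, hm⟩⟩
  obtain ⟨hs, -⟩ := hsOf i
  have hW := hwbar _ hs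
  have hT0 : (0 : ℝ) < T := by exact_mod_cast hT
  have hm0 : (0 : ℝ) < m := by exact_mod_cast hm
  have hη' : 0 < √η := Real.sqrt_pos.2 hη
  have hcard : (1 : ℝ) ≤ (sOf i).card := by exact_mod_cast (hSne _ hs).card_pos
  set R := ∑ s ∈ S, √((s.card : ℝ) / (wbar w s * T))
  have hR0 : 0 ≤ R := Finset.sum_nonneg fun _ _ => Real.sqrt_nonneg _
  have hcount : √(1 / (((T : ℝ) + 1) * wbar w (sOf i))) ≤ R := by
    refine le_trans (Real.sqrt_le_sqrt ?_) (Finset.single_le_sum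
      (f := fun s : Finset (Fin n) => √((s.card : ℝ) / (wbar w s * T)))
      (fun _ _ => Real.sqrt_nonneg _) hs)
    rw [mul_comm]
    gcongr
    linarith
  have hfreq : ∑ s ∈ S, iidExp w (fun h : Fin T → Fin n => groupFreqDist w h s) ≤ 3 * R := by
    rw [Finset.mul_sum]
    exact Finset.sum_le_sum fun s hs =>
      iidExp_groupFreqDist_le hw0 hw1 (hSne s hs) (hwbar s hs) hT
  have hratio := iidExp_abs_div_groupcount_add_one_le (T := T) hw0 hw1 hW
  refine (iidExp_mono hw0 fun h => ciSup_le fun j =>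
    abs_approxGradient_sub_gbal_le hm μ hβ hη hs hW hpihat0 ha01 h j).trans ?_
  rw [iidExp_const_mul, iidExp_add, iidExp_const_mul, iidExp_sum]
  have hpos : 0 ≤ 1 / (wbar w (sOf i) * ((T : ℝ) + 1)) := by positivity
  have hmin : 0 < min η √η := lt_min hη hη'
  refine mul_le_mul ?_ (by linarith) ?_ (by positivity)
  · gcongr
    exact min_le_right _ _
  · rw [← iidExp_sum, ← iidExp_const_mul, ← iidExp_add]
    refine Finset.sum_nonneg fun h _ => mul_nonneg (Finset.prod_nonneg fun _ _ => hw0 _) ?_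
    have : 0 ≤ ∑ s ∈ S, groupFreqDist w h s :=
      Finset.sum_nonneg fun s _ => Finset.sum_nonneg fun _ _ => abs_nonneg _
    positivity
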